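/- Let (Λ, ξ) be a decorated D-lattice of dimension N ≡ 5 (mod 8), N = 8k+5, and let v ∈ Λ be a unigonal vector (v² = -12, div(v) = 4). Then v^⊥ is isomorphic to II_{2,2+8k} ⊕ A₂. -/

import Mathlib

noncomputable section

open scoped BigOperators

/-- `x` has integer entries. -/
def IntVec {n : ℕ} (x : Fin n → ℚ) : Prop := ∀ i, ∃ a : ℤ, x i = (a : ℚ)

/-- The lattice `D_n = {x ∈ ℤⁿ : Σ xᵢ ≡ 0 mod 2}` (viewed inside `ℚⁿ`),
equipped with the negative of the Euclidean form `negE`. -/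
def DSet (n : ℕ) : Set (Fin n → ℚ) :=
  {x | IntVec x ∧ ∃ a : ℤ, (∑ i, x i) = 2 * (a : ℚ)}

/-- The negative of the standard Euclidean bilinear form. -/
def negE {n : ℕ} (x y : Fin n → ℚ) : ℚ := - ∑ i, x i * y i

/-- The vector `(1/2, …, 1/2)`. -/
def halfVec (n : ℕ) : Fin n → ℚ := fun _ => 1/2

/-- The lattice `Λ_N = U² ⊕ D_{N-2}` realized inside `ℚ^{N+2}`: integral vectors whose
coordinates of index `≥ 4` have even sum.  The first four coordinates carry the two
hyperbolic planes. -/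
def LamSet (N : ℕ) : Set (Fin (N + 2) → ℚ) :=
  {x | IntVec x ∧ ∃ a : ℤ, (∑ i : Fin (N + 2), if 4 ≤ (i : ℕ) then x i else 0) = 2 * (a : ℚ)}

/-- The bilinear form of `Λ_N = U² ⊕ D_{N-2}`. -/
def LamForm (N : ℕ) (x y : Fin (N + 2) → ℚ) : ℚ :=
  x 0 * y 1 + x 1 * y 0 + x 2 * y 3 + x 3 * y 2
    - ∑ i : Fin (N + 2), (if 4 ≤ (i : ℕ) then x i * y i else 0)

/-- The (negative definite) `E₈` lattice inside `ℚ⁸`: vectors that are integral or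
half-integral, with even coordinate sum; the form is `negE`. -/
def E8Set : Set (Fin 8 → ℚ) :=
  {x | (IntVec x ∨ IntVec (x - halfVec 8)) ∧ ∃ a : ℤ, (∑ i, x i) = 2 * (a : ℚ)}

/-- Ambient space for the even unimodular lattice `II_{2,2+8k} = U² ⊕ E₈^k`. -/
abbrev IIAmb (k : ℕ) := (Fin 4 → ℚ) × (Fin k → Fin 8 → ℚ)

/-- The form of `U²` on `ℚ⁴`. -/
def UForm (x y : Fin 4 → ℚ) : ℚ := x 0 * y 1 + x 1 * y 0 + x 2 * y 3 + x 3 * y 2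

/-- The bilinear form of `II_{2,2+8k} = U² ⊕ E₈^k`. -/
def IIForm (k : ℕ) (x y : IIAmb k) : ℚ := UForm x.1 y.1 + ∑ j, negE (x.2 j) (y.2 j)

/-- The even unimodular lattice `II_{2,2+8k} = U² ⊕ E₈^k` inside its ambient space. -/
def IISet (k : ℕ) : Set (IIAmb k) := {p | IntVec p.1 ∧ ∀ j, p.2 j ∈ E8Set}

/-- `v` has divisibility `d` in `Λ_N`: all pairings with lattice vectors are divisible
by `d`, and `d` is attained. -/
def HasDiv (N : ℕ) (v : Fin (N + 2) → ℚ) (d : ℤ) : Prop :=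
  (∀ x ∈ LamSet N, ∃ a : ℤ, LamForm N v x = (d : ℚ) * a) ∧
  ∃ x ∈ LamSet N, LamForm N v x = (d : ℚ)

/-- `ξ` represents a decoration of `Λ_N`: an element of the dual lattice whose class in
the discriminant group has square `1` modulo `2ℤ`. -/
def IsDeco (N : ℕ) (ξ : Fin (N + 2) → ℚ) : Prop :=
  (∀ y ∈ LamSet N, ∃ a : ℤ, LamForm N ξ y = (a : ℚ)) ∧
  ∃ a : ℤ, LamForm N ξ ξ = 1 + 2 * (a : ℚ)

/-- The bilinear form of the (negative definite) root lattice `A₂` on `ℚ²`, with Gram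
matrix `[[-2, 1], [1, -2]]`; the lattice itself is the set of integral vectors. -/
def A2Form (x y : Fin 2 → ℚ) : ℚ :=
  -(2 * (x 0 * y 0)) + x 0 * y 1 + x 1 * y 0 - 2 * (x 1 * y 1)

section Abstract

variable {V : Type} [AddCommGroup V] [Module ℚ V]

/-- Isometry of the lattice carrying the first vector to the second. -/
def LRel (B : V →ₗ[ℚ] V →ₗ[ℚ] ℚ) (L : AddSubgroup V) (v v' : V) : Prop :=
  ∃ g : V ≃ₗ[ℚ] V, (∀ x y, B (g x) (g y) = B x y) ∧ (∀ x, g x ∈ L ↔ x ∈ L) ∧ g v = v'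

theorem LRel.trans {B : V →ₗ[ℚ] V →ₗ[ℚ] ℚ} {L : AddSubgroup V} {u v w : V}
    (h : LRel B L u v) (h' : LRel B L v w) : LRel B L u w := by
  obtain ⟨g, h1, h2, h3⟩ := h
  obtain ⟨k, k1, k2, k3⟩ := h'
  refine ⟨g.trans k, ?_, ?_, ?_⟩
  · intro x y; simp [h1, k1]
  · intro x; simp [h2, k2]
  · simp [h3, k3]

theorem LRel.symm {B : V →ₗ[ℚ] V →ₗ[ℚ] ℚ} {L : AddSubgroup V} {u v : V}
    (h : LRel B L u v) : LRel B L v u := by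
  obtain ⟨g, h1, h2, h3⟩ := h
  refine ⟨g.symm, ?_, ?_, ?_⟩
  · intro x y; rw [← h1]; simp
  · intro x; rw [← h2]; simp
  · rw [← h3]; simp

theorem LRel.refl {B : V →ₗ[ℚ] V →ₗ[ℚ] ℚ} {L : AddSubgroup V} (u : V) : LRel B L u u :=
  ⟨LinearEquiv.refl ℚ V, by simp, by simp, by simp⟩

/-- Same orbit and same class modulo `L`. -/
def Orb (B : V →ₗ[ℚ] V →ₗ[ℚ] ℚ) (L : AddSubgroup V) (v v' : V) : Prop :=
  LRel B L v v' ∧ v' - v ∈ L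

theorem Orb.trans {B : V →ₗ[ℚ] V →ₗ[ℚ] ℚ} {L : AddSubgroup V} {u v w : V}
    (h : Orb B L u v) (h' : Orb B L v w) : Orb B L u w :=
  ⟨h.1.trans h'.1, by have := L.add_mem h.2 h'.2; simpa using this⟩

theorem Orb.refl {B : V →ₗ[ℚ] V →ₗ[ℚ] ℚ} {L : AddSubgroup V} (u : V) : Orb B L u u :=
  ⟨LRel.refl u, by simp⟩

/-- Element of the dual lattice that is primitive there. -/
def PDual (B : V →ₗ[ℚ] V →ₗ[ℚ] ℚ) (L : AddSubgroup V) (v : V) : Prop :=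
  (∀ x ∈ L, ∃ n : ℤ, B v x = n) ∧ ∃ x ∈ L, B v x = 1

theorem PDual.rel {B : V →ₗ[ℚ] V →ₗ[ℚ] ℚ} {L : AddSubgroup V} {u v : V}
    (h : PDual B L u) (h' : LRel B L u v) : PDual B L v := by
  obtain ⟨g, h1, h2, rfl⟩ := h'
  constructor
  · intro x hx
    obtain ⟨n, hn⟩ := h.1 (g.symm x) (by rw [← h2]; simpa using hx)
    exact ⟨n, by rw [← hn, ← h1 u, g.apply_symm_apply]⟩
  · obtain ⟨x, hx, h3⟩ := h.2
    exact ⟨g x, (h2 x).2 hx, by rw [h1, h3]⟩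

/-- An even lattice. -/
structure EvenLat (B : V →ₗ[ℚ] V →ₗ[ℚ] ℚ) (L : AddSubgroup V) : Prop where
  symm : ∀ x y, B x y = B y x
  int : ∀ x ∈ L, ∀ y ∈ L, ∃ n : ℤ, B x y = n
  even : ∀ x ∈ L, ∃ n : ℤ, B x x = 2 * n

/-- The Eichler transvection as a linear map. -/
def eich (B : V →ₗ[ℚ] V →ₗ[ℚ] ℚ) (e a : V) : V →ₗ[ℚ] V :=
  LinearMap.id - (B a).smulRight e + (B e).smulRight a - ((1/2 * B a a) • (B e)).smulRight e

theorem eich_apply (B : V →ₗ[ℚ] V →ₗ[ℚ] ℚ) (e a x : V) :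
    eich B e a x = x - B a x • e + B e x • a - (1/2 * B a a * B e x) • e := by
  simp [eich]

theorem int_smul_mem {L : AddSubgroup V} {x : V} (hx : x ∈ L) {q : ℚ} (h : ∃ n : ℤ, q = n) :
    q • x ∈ L := by
  obtain ⟨n, rfl⟩ := h
  rw [Int.cast_smul_eq_zsmul]
  exact L.zsmul_mem hx n

theorem eich_diff {B : V →ₗ[ℚ] V →ₗ[ℚ] ℚ} {L : AddSubgroup V} (hL : EvenLat B L) {e a x : V}
    (he : e ∈ L) (ha : a ∈ L) (hx : ∀ y ∈ L, ∃ n : ℤ, B x y = n) : eich B e a x - x ∈ L := by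
  rw [eich_apply]
  obtain ⟨n, hn⟩ := hx a ha
  obtain ⟨m, hm⟩ := hx e he
  obtain ⟨k, hk⟩ := hL.even a ha
  rw [hL.symm a x, hL.symm e x, hn, hm, hk]
  have : x - (n : ℚ) • e + (m : ℚ) • a - (1/2 * (2 * (k:ℚ)) * m) • e - x
      = (m : ℚ) • a - (n : ℚ) • e - ((k * m : ℤ) : ℚ) • e := by
    have : (1/2 * (2 * (k:ℚ)) * m) = ((k * m : ℤ) : ℚ) := by push_cast; ring
    rw [this]; abel
  rw [this]
  exact L.sub_mem (L.sub_mem (int_smul_mem ha ⟨_, rfl⟩) (int_smul_mem he ⟨_, rfl⟩))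
    (int_smul_mem he ⟨_, rfl⟩)

theorem eich_inv {B : V →ₗ[ℚ] V →ₗ[ℚ] ℚ} {L : AddSubgroup V} (hL : EvenLat B L) {e a : V}
    (hee : B e e = 0) (hae : B a e = 0) (x : V) : eich B e (-a) (eich B e a x) = x := by
  have hea : B e a = 0 := by rw [hL.symm, hae]
  simp only [eich_apply, map_add, map_sub, map_neg, map_smul, LinearMap.neg_apply, smul_eq_mul,
    hee, hae, hea]
  module

theorem eich_orb {B : V →ₗ[ℚ] V →ₗ[ℚ] ℚ} {L : AddSubgroup V} (hL : EvenLat B L) {e a v : V}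
    (he : e ∈ L) (ha : a ∈ L) (hee : B e e = 0) (hae : B a e = 0)
    (hv : ∀ y ∈ L, ∃ n : ℤ, B v y = n) : Orb B L v (eich B e a v) := by
  have hea : B e a = 0 := by rw [hL.symm, hae]
  refine ⟨⟨LinearEquiv.ofLinearMap (eich B e a) (eich B e (-a)) ?_ ?_, ?_, ?_, rfl⟩,
    eich_diff hL he ha hv⟩
  · ext x
    have := eich_inv hL (a := -a) hee (by simp [hae]) x
    simpa using this
  · ext x
    simpa using eich_inv hL hee hae x
  · intro x y
    simp only [LinearEquiv.coe_ofLinearMap, eich_apply, map_add, map_sub, map_smul,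
      LinearMap.add_apply, LinearMap.sub_apply, LinearMap.smul_apply, smul_eq_mul,
      hee, hae, hea, hL.symm x e, hL.symm x a]
    ring
  · have key : ∀ a x, a ∈ L → x ∈ L → eich B e a x ∈ L := by
      intro a x ha hx
      have := L.add_mem (eich_diff hL he ha (hL.int x hx)) hx
      simpa using this
    intro x
    simp only [LinearEquiv.coe_ofLinearMap]
    constructor
    · intro h
      have := key (-a) _ (L.neg_mem ha) h
      rwa [eich_inv hL hee hae] at this
    · exact key a x ha

/-- Two orthogonal hyperbolic planes in `L`. -/
structure Hyp (B : V →ₗ[ℚ] V →ₗ[ℚ] ℚ) (L : AddSubgroup V) (e f e1 f1 : V) : Prop where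
  me : e ∈ L
  mf : f ∈ L
  me1 : e1 ∈ L
  mf1 : f1 ∈ L
  ee : B e e = 0
  ff : B f f = 0
  ee1 : B e1 e1 = 0
  ff1 : B f1 f1 = 0
  ef : B e f = 1
  ef1 : B e1 f1 = 1
  x1 : B e e1 = 0
  x2 : B e f1 = 0
  x3 : B f e1 = 0
  x4 : B f f1 = 0

theorem Hyp.flip {B : V →ₗ[ℚ] V →ₗ[ℚ] ℚ} {L : AddSubgroup V} (hL : EvenLat B L) {e f e1 f1 : V}
    (h : Hyp B L e f e1 f1) : Hyp B L f e e1 f1 :=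
  ⟨h.mf, h.me, h.me1, h.mf1, h.ff, h.ee, h.ee1, h.ff1, by rw [hL.symm, h.ef], h.ef1,
    h.x3, h.x4, h.x1, h.x2⟩

theorem Hyp.swap {B : V →ₗ[ℚ] V →ₗ[ℚ] ℚ} {L : AddSubgroup V} (hL : EvenLat B L) {e f e1 f1 : V}
    (h : Hyp B L e f e1 f1) : Hyp B L e1 f1 e f :=
  ⟨h.me1, h.mf1, h.me, h.mf, h.ee1, h.ff1, h.ee, h.ff, h.ef1, h.ef,
    by rw [hL.symm, h.x1], by rw [hL.symm, h.x3], by rw [hL.symm, h.x2], by rw [hL.symm, h.x4]⟩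

theorem red_int (n b : ℤ) (hb : b ≠ 0) (h : ¬ b ∣ n) :
    ∃ t : ℤ, n + t * b ≠ 0 ∧ (n + t * b).natAbs < b.natAbs := by
  refine ⟨-(n / b), ?_, ?_⟩
  · intro h'
    exact h ⟨n / b, by linarith⟩
  · have h1 := Int.emod_add_mul_ediv n b
    have h2 : n + -(n / b) * b = n % b := by linarith
    rw [h2]
    have h3 := Int.emod_nonneg n hb
    have h4 := Int.emod_lt_abs n hb
    zify
    rwa [abs_of_nonneg h3]

/-- The move adding a multiple of `B v e` to `B v e1`. -/
theorem move {B : V →ₗ[ℚ] V →ₗ[ℚ] ℚ} {L : AddSubgroup V} (hL : EvenLat B L) {e f e1 f1 v : V}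
    (h : Hyp B L e f e1 f1) (hv : PDual B L v) (t : ℤ) :
    ∃ v', Orb B L v v' ∧ B v' e = B v e ∧ B v' e1 = B v e1 + t * B v e ∧
      B v' f = B v f - t * B v f1 ∧ B v' f1 = B v f1 := by
  refine ⟨_, eich_orb hL (e := e) (a := (t : ℚ) • f1) h.me (int_smul_mem h.mf1 ⟨_, rfl⟩) h.ee
    (by simp [hL.symm f1 e, h.x2]) hv.1, ?_⟩
  simp only [eich_apply, map_add, map_sub, map_smul,
      LinearMap.add_apply, LinearMap.sub_apply, LinearMap.smul_apply, smul_eq_mul,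
      h.ee, h.ff1, h.x2, h.ef, h.x1, hL.symm f1 e, hL.symm f1 e1, hL.symm f1 f, h.ef1, h.x4,
      hL.symm f1 v, hL.symm e v]
  refine ⟨by ring, by ring, by ring, by ring⟩

/-- One of the four pairings is a unit. -/
def Unit4 (B : V →ₗ[ℚ] V →ₗ[ℚ] ℚ) (e f e1 f1 v : V) : Prop :=
  B v e ^ 2 = 1 ∨ B v f ^ 2 = 1 ∨ B v e1 ^ 2 = 1 ∨ B v f1 ^ 2 = 1

theorem descent {B : V →ₗ[ℚ] V →ₗ[ℚ] ℚ} {L : AddSubgroup V} (hL : EvenLat B L) (m : ℕ) :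
    ∀ (e f e1 f1 : V), Hyp B L e f e1 f1 → ∀ v, PDual B L v → ∀ n : ℤ, B v e = n → n ≠ 0 →
      n.natAbs = m → ∃ v', Orb B L v v' ∧ Unit4 B e f e1 f1 v' := by
  induction m using Nat.strong_induction_on with
  | _ m ih =>
  intro e f e1 f1 h v hv n hn hn0 hm
  -- first reduction
  have step1 : ∀ (e1 f1 : V), Hyp B L e f e1 f1 → ∀ v, PDual B L v → B v e = n → ∀ c : ℤ,
      B v e1 = c → ¬ n ∣ c → ∃ v', Orb B L v v' ∧ Unit4 B e f e1 f1 v' := by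
    intro e1 f1 h v hv hn c hc hnc
    obtain ⟨t, ht0, ht⟩ := red_int c n hn0 hnc
    obtain ⟨v', ho, -, h1, -⟩ := move hL h hv t
    obtain ⟨v'', ho', hu⟩ := ih _ (hm ▸ ht) e1 f1 e f (h.swap hL) v' (hv.rel ho.1) (c + t * n)
      (by rw [h1, hc, hn]; push_cast; ring) ht0 rfl
    refine ⟨v'', ho.trans ho', ?_⟩
    unfold Unit4 at hu ⊢
    tauto
  have hflip1 : Hyp B L e f f1 e1 := ((h.swap hL).flip hL).swap hL
  have step2 : ∀ v, PDual B L v → B v e = n → ∀ c : ℤ,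
      B v f = c → ¬ n ∣ c → ∃ v', Orb B L v v' ∧ Unit4 B e f e1 f1 v' := by
    intro v hv hn c hc hnc
    obtain ⟨g, hg⟩ := hv.1 e1 h.me1
    obtain ⟨d, hd⟩ := hv.1 f1 h.mf1
    by_cases hng : n ∣ g
    swap
    · exact step1 e1 f1 h v hv hn g hg hng
    by_cases hnd : n ∣ d
    swap
    · obtain ⟨v', h1, h2⟩ := step1 f1 e1 hflip1 v hv hn d hd hnd
      exact ⟨v', h1, by unfold Unit4 at h2 ⊢; tauto⟩
    obtain ⟨g', rfl⟩ := hng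
    obtain ⟨v1, o1, a1, b1, c1, d1⟩ := move hL h hv (1 - g')
    have hnc' : ¬ n ∣ (c - (1 - g') * d) := by
      intro hh
      exact hnc ((Int.dvd_iff_dvd_of_dvd_sub (by simpa using Dvd.dvd.mul_left hnd (1 - g'))).2 hh)
    obtain ⟨t, ht0, ht⟩ := red_int _ n hn0 hnc'
    have hq : Hyp B L e1 f1 f e := (((h.flip hL)).swap hL)
    obtain ⟨v2, o2, a2, b2, c2, d2⟩ := move hL hq (hv.rel o1.1) t
    obtain ⟨v3, o3, hu⟩ := ih _ (hm ▸ ht) f e e1 f1 (h.flip hL) v2 ((hv.rel o1.1).rel o2.1)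
      (c - (1 - g') * d + t * n) (by rw [b2, c1, b1, hc, hd, hg, hn]; push_cast; ring) ht0 rfl
    exact ⟨v3, (o1.trans o2).trans o3, by unfold Unit4 at hu ⊢; tauto⟩
  by_cases hm1 : n.natAbs = 1
  · refine ⟨v, Orb.refl v, Or.inl ?_⟩
    rw [hn]
    have : n ^ 2 = 1 := by rw [← Int.natAbs_sq, hm1]; rfl
    exact_mod_cast this
  obtain ⟨c, hc⟩ := hv.1 f h.mf
  by_cases hnc : n ∣ c
  swap
  · exact step2 v hv hn c hc hnc
  obtain ⟨x, hx, hvx⟩ := hv.2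
  obtain ⟨p, hp⟩ := hL.int x hx e h.me
  obtain ⟨q, hq⟩ := hL.int x hx f h.mf
  -- projection of x
  set a := x - (q : ℚ) • e - (p : ℚ) • f with ha
  have haL : a ∈ L := L.sub_mem (L.sub_mem hx (int_smul_mem h.me ⟨_, rfl⟩))
    (int_smul_mem h.mf ⟨_, rfl⟩)
  have hfe : B f e = 1 := by rw [hL.symm, h.ef]
  have hae : B a e = 0 := by simp [ha, hp, h.ee, hfe]
  have haf : B a f = 0 := by simp [ha, hq, h.ff, h.ef]
  obtain ⟨s, hs⟩ := hL.even a haL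
  have hav : B a v = 1 - q * n - p * c := by
    rw [hL.symm, ha]; simp [hvx, hn, hc]
  have ho := eich_orb hL h.me haL h.ee hae hv.1
  obtain ⟨v', o', hu⟩ := step2 (eich B e a v) (hv.rel ho.1)
    (by simp [eich_apply, hae, h.ee, hn])
    (c - (1 - q * n - p * c) - s * n)
    (by simp [eich_apply, haf, h.ef, hn, hav, hs, hL.symm e v, hc])
    (by
      intro hd
      obtain ⟨c', rfl⟩ := hnc
      have : n ∣ 1 := by
        have h2 : n ∣ n * (c' + q + p * c' - s) := Dvd.intro _ rfl
        have := dvd_sub h2 hd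
        ring_nf at this
        simpa using this
      exact hm1 (Int.natAbs_of_isUnit (isUnit_of_dvd_one this)))
  exact ⟨v', ho.trans o', hu⟩

theorem to_unit {B : V →ₗ[ℚ] V →ₗ[ℚ] ℚ} {L : AddSubgroup V} (hL : EvenLat B L) {e f e1 f1 v : V}
    (h : Hyp B L e f e1 f1) (hv : PDual B L v) : ∃ v', Orb B L v v' ∧ Unit4 B e f e1 f1 v' := by
  obtain ⟨n, hn⟩ := hv.1 e h.me
  obtain ⟨c, hc⟩ := hv.1 f h.mf
  by_cases hn0 : n = 0
  swap
  · exact descent hL _ e f e1 f1 h v hv n hn hn0 rfl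
  by_cases hc0 : c = 0
  swap
  · obtain ⟨v', o, hu⟩ := descent hL _ f e e1 f1 (h.flip hL) v hv c hc hc0 rfl
    exact ⟨v', o, by unfold Unit4 at hu ⊢; tauto⟩
  subst hn0 hc0
  obtain ⟨x, hx, hvx⟩ := hv.2
  obtain ⟨p, hp⟩ := hL.int x hx e h.me
  obtain ⟨q, hq⟩ := hL.int x hx f h.mf
  set a := x - (q : ℚ) • e - (p : ℚ) • f with ha
  have haL : a ∈ L := L.sub_mem (L.sub_mem hx (int_smul_mem h.me ⟨_, rfl⟩))
    (int_smul_mem h.mf ⟨_, rfl⟩)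
  have hfe : B f e = 1 := by rw [hL.symm, h.ef]
  have hae : B a e = 0 := by simp [ha, hp, h.ee, hfe]
  have haf : B a f = 0 := by simp [ha, hq, h.ff, h.ef]
  have hav : B a v = 1 := by
    rw [hL.symm, ha]; simp [hvx, hn, hc]
  refine ⟨_, eich_orb hL h.me haL h.ee hae hv.1, Or.inr (Or.inl ?_)⟩
  simp [eich_apply, haf, h.ef, hn, hav, hL.symm e v, hc]

theorem unit_move {B : V →ₗ[ℚ] V →ₗ[ℚ] ℚ} {L : AddSubgroup V} (hL : EvenLat B L)
    {e f e1 f1 v : V} (h : Hyp B L e f e1 f1) (hv : PDual B L v) (h1 : B v e ^ 2 = 1) :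
    ∃ v', Orb B L v v' ∧ B v' e1 = 1 := by
  obtain ⟨n, hn⟩ := hv.1 e h.me
  obtain ⟨c, hc⟩ := hv.1 e1 h.me1
  obtain ⟨v', o, -, hh, -⟩ := move hL h hv ((1 - c) * n)
  refine ⟨v', o, ?_⟩
  rw [hh, hc, hn]
  rw [hn] at h1
  push_cast
  linear_combination (1 - (c : ℚ)) * h1

theorem to_one {B : V →ₗ[ℚ] V →ₗ[ℚ] ℚ} {L : AddSubgroup V} (hL : EvenLat B L) {e f e1 f1 v : V}
    (h : Hyp B L e f e1 f1) (hv : PDual B L v) : ∃ v', Orb B L v v' ∧ B v' e = 1 := by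
  obtain ⟨v1, o1, hu⟩ := to_unit hL h hv
  have hv1 := hv.rel o1.1
  have hs := h.swap hL
  have second : ∀ v2, Orb B L v1 v2 → B v2 e1 = 1 → ∃ v', Orb B L v v' ∧ B v' e = 1 := by
    intro v2 o2 h2
    obtain ⟨v3, o3, h3⟩ := unit_move hL hs (hv1.rel o2.1) (by rw [h2]; norm_num)
    exact ⟨v3, (o1.trans o2).trans o3, h3⟩
  rcases hu with hu | hu | hu | hu
  · obtain ⟨v2, o2, h2⟩ := unit_move hL h hv1 hu
    exact second v2 o2 h2
  · obtain ⟨v2, o2, h2⟩ := unit_move hL (h.flip hL) hv1 hu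
    exact second v2 o2 h2
  · obtain ⟨v2, o2, h2⟩ := unit_move hL hs hv1 hu
    exact ⟨v2, o1.trans o2, h2⟩
  · obtain ⟨v2, o2, h2⟩ := unit_move hL (hs.flip hL) hv1 hu
    exact ⟨v2, o1.trans o2, h2⟩

/-- The Eichler criterion. -/
theorem eichler {B : V →ₗ[ℚ] V →ₗ[ℚ] ℚ} {L : AddSubgroup V} (hL : EvenLat B L) {e f e1 f1 : V}
    (h : Hyp B L e f e1 f1) {v w : V} (hv : PDual B L v) (hw : PDual B L w)
    (hn : B v v = B w w) (hd : v - w ∈ L) : LRel B L v w := by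
  obtain ⟨v', ov, hv1⟩ := to_one hL h hv
  obtain ⟨w', ow, hw1⟩ := to_one hL h hw
  have norm : ∀ u u', LRel B L u u' → B u' u' = B u u := by
    rintro u u' ⟨g, g1, -, rfl⟩
    exact g1 u u
  have hn' : B v' v' = B w' w' := by rw [norm _ _ ov.1, norm _ _ ow.1, hn]
  have hd' : w' - v' ∈ L := by
    have := L.sub_mem (L.sub_mem ow.2 ov.2) hd
    have e : w' - w - (v' - v) - (v - w) = w' - v' := by abel
    rwa [e] at this
  refine ov.1.trans (LRel.trans ?_ ow.1.symm)
  have hv' := hv.rel ov.1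
  set t := B (w' - v') f with ht
  set a := w' - v' - t • e with ha
  have hae : B a e = 0 := by simp [ha, hv1, hw1, h.ee]
  have haf : B a f = 0 := by
    rw [ha, map_sub, LinearMap.sub_apply, ← ht, map_smul, LinearMap.smul_apply, h.ef]; simp
  have haL : a ∈ L := L.sub_mem hd' (int_smul_mem h.me (hL.int _ hd' _ h.mf))
  have o := eich_orb hL h.me haL h.ee hae hv'.1
  have hw' : w' = v' + a + t • e := by rw [ha]; abel
  have key : eich B e a v' = w' := by
    have hs : eich B e a v' = v' + a + (-(B a v') - 1/2 * B a a) • e := by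
      rw [eich_apply, hL.symm e v', hv1]; module
    rw [hs, hw']
    congr 2
    have := norm _ _ o.1
    rw [hw'] at hn'
    simp only [map_add, LinearMap.add_apply, map_smul, LinearMap.smul_apply, smul_eq_mul, hae,
      hL.symm e v', hL.symm e a, h.ee, hv1, hL.symm v' a] at hn'
    linarith
  rw [← key]
  exact o.1

end Abstract

section Concrete

set_option linter.unusedSimpArgs false

theorem fin_val2 (N : ℕ) (hN : 5 ≤ N) : ((2 : Fin (N + 2)) : ℕ) = 2 := by
  have : 2 % (N + 2) = 2 := Nat.mod_eq_of_lt (by omega)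
  exact this

theorem fin_val3 (N : ℕ) (hN : 5 ≤ N) : ((3 : Fin (N + 2)) : ℕ) = 3 := by
  have : 3 % (N + 2) = 3 := Nat.mod_eq_of_lt (by omega)
  exact this

theorem sq_par {ι : Type} (s : Finset ι) (x : ι → ℚ) (hx : ∀ i ∈ s, ∃ a : ℤ, x i = a) :
    ∃ m : ℤ, ∑ i ∈ s, x i * x i = ∑ i ∈ s, x i + 2 * m := by
  classical
  induction s using Finset.induction_on with
  | empty => exact ⟨0, by simp⟩
  | insert i s hi ih =>
    obtain ⟨m, hm⟩ := ih (fun j hj => hx j (Finset.mem_insert_of_mem hj))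
    obtain ⟨a, ha⟩ := hx i (Finset.mem_insert_self _ _)
    obtain ⟨c, hc⟩ : (2 : ℤ) ∣ a * a - a := by
      have := Int.even_mul_pred_self a
      rw [mul_sub, mul_one] at this
      exact this.two_dvd
    refine ⟨m + c, ?_⟩
    rw [Finset.sum_insert hi, Finset.sum_insert hi, hm, ha]
    have hc' : (a : ℚ) * a - a = 2 * c := by exact_mod_cast hc
    push_cast
    linarith

theorem int_sum {ι : Type} (s : Finset ι) (x : ι → ℚ) (hx : ∀ i ∈ s, ∃ a : ℤ, x i = a) :
    ∃ m : ℤ, ∑ i ∈ s, x i = m := by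
  classical
  induction s using Finset.induction_on with
  | empty => exact ⟨0, by simp⟩
  | insert i s hi ih =>
    obtain ⟨m, hm⟩ := ih (fun j hj => hx j (Finset.mem_insert_of_mem hj))
    obtain ⟨a, ha⟩ := hx i (Finset.mem_insert_self _ _)
    exact ⟨a + m, by rw [Finset.sum_insert hi, ha, hm]; push_cast; ring⟩

/-- `LamForm` as a bilinear map. -/
def LamB (N : ℕ) : (Fin (N + 2) → ℚ) →ₗ[ℚ] (Fin (N + 2) → ℚ) →ₗ[ℚ] ℚ :=
  LinearMap.mk₂ ℚ (LamForm N)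
    (by
      intro x y z
      have : ∀ i : Fin (N + 2), (if 4 ≤ (i : ℕ) then (x + y) i * z i else 0)
        = (if 4 ≤ (i : ℕ) then x i * z i else 0) + (if 4 ≤ (i : ℕ) then y i * z i else 0) := by
        intro i; split_ifs <;> simp; ring
      simp only [LamForm, this, Finset.sum_add_distrib]; simp only [Pi.add_apply]; ring)
    (by
      intro c x z
      have : ∀ i : Fin (N + 2), (if 4 ≤ (i : ℕ) then (c • x) i * z i else 0)
        = c * (if 4 ≤ (i : ℕ) then x i * z i else 0) := by
        intro i; split_ifs <;> simp; ring
      simp only [LamForm, this, ← Finset.mul_sum]; simp only [Pi.smul_apply, smul_eq_mul]; ring)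
    (by
      intro z x y
      have : ∀ i : Fin (N + 2), (if 4 ≤ (i : ℕ) then z i * (x + y) i else 0)
        = (if 4 ≤ (i : ℕ) then z i * x i else 0) + (if 4 ≤ (i : ℕ) then z i * y i else 0) := by
        intro i; split_ifs <;> simp; ring
      simp only [LamForm, this, Finset.sum_add_distrib]; simp only [Pi.add_apply]; ring)
    (by
      intro c z x
      have : ∀ i : Fin (N + 2), (if 4 ≤ (i : ℕ) then z i * (c • x) i else 0)
        = c * (if 4 ≤ (i : ℕ) then z i * x i else 0) := by
        intro i; split_ifs <;> simp; ring
      simp only [LamForm, this, ← Finset.mul_sum]; simp only [Pi.smul_apply, smul_eq_mul]; ring)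

theorem LamB_apply (N : ℕ) (x y : Fin (N + 2) → ℚ) : LamB N x y = LamForm N x y := rfl

/-- Tail sum. -/
def tailSum (N : ℕ) (x : Fin (N + 2) → ℚ) : ℚ :=
  ∑ i : Fin (N + 2), if 4 ≤ (i : ℕ) then x i else 0

theorem tailSum_add (N : ℕ) (x y : Fin (N + 2) → ℚ) :
    tailSum N (x + y) = tailSum N x + tailSum N y := by
  unfold tailSum
  rw [← Finset.sum_add_distrib]
  refine Finset.sum_congr rfl fun i _ => ?_
  split_ifs <;> simp

theorem tailSum_neg (N : ℕ) (x : Fin (N + 2) → ℚ) :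
    tailSum N (-x) = - tailSum N x := by
  unfold tailSum
  rw [← Finset.sum_neg_distrib]
  refine Finset.sum_congr rfl fun i _ => ?_
  split_ifs <;> simp

theorem tailSum_single (N : ℕ) (i : Fin (N + 2)) (a : ℚ) :
    tailSum N (Pi.single i a) = if 4 ≤ (i : ℕ) then a else 0 := by
  unfold tailSum
  rw [Finset.sum_eq_single i]
  · simp
  · intro j _ hj
    simp [Pi.single_eq_of_ne hj]
  · simp

/-- The lattice as a subgroup. -/
def LamL (N : ℕ) : AddSubgroup (Fin (N + 2) → ℚ) where
  carrier := LamSet N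
  zero_mem' := ⟨fun i => ⟨0, by simp⟩, 0, by simp⟩
  add_mem' := by
    rintro x y ⟨hx, a, ha⟩ ⟨hy, b, hb⟩
    refine ⟨fun i => ?_, a + b, ?_⟩
    · obtain ⟨c, hc⟩ := hx i
      obtain ⟨d, hd⟩ := hy i
      exact ⟨c + d, by simp [hc, hd]⟩
    · have := tailSum_add N x y
      unfold tailSum at this
      rw [this, ha, hb]; push_cast; ring
  neg_mem' := by
    rintro x ⟨hx, a, ha⟩
    refine ⟨fun i => ?_, -a, ?_⟩
    · obtain ⟨c, hc⟩ := hx i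
      exact ⟨-c, by simp [hc]⟩
    · have := tailSum_neg N x
      unfold tailSum at this
      rw [this, ha]; push_cast; ring

theorem mem_LamL (N : ℕ) (x : Fin (N + 2) → ℚ) :
    x ∈ LamL N ↔ IntVec x ∧ ∃ a : ℤ, tailSum N x = 2 * a := Iff.rfl

theorem mem_LamL' (N : ℕ) (x : Fin (N + 2) → ℚ) : x ∈ LamL N ↔ x ∈ LamSet N := Iff.rfl

theorem Lam_int (N : ℕ) (x y : Fin (N + 2) → ℚ) (hx : IntVec x) (hy : IntVec y) :
    ∃ n : ℤ, LamForm N x y = n := by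
  choose a ha using hx
  choose b hb using hy
  refine ⟨a 0 * b 1 + a 1 * b 0 + a 2 * b 3 + a 3 * b 2
    - ∑ i : Fin (N + 2), (if 4 ≤ (i : ℕ) then a i * b i else 0), ?_⟩
  simp only [LamForm, ha, hb]
  push_cast
  rfl

theorem Lam_even (N : ℕ) : EvenLat (LamB N) (LamL N) where
  symm x y := by
    simp only [LamB_apply, LamForm]
    have : ∀ i : Fin (N + 2), (if 4 ≤ (i : ℕ) then x i * y i else 0)
        = (if 4 ≤ (i : ℕ) then y i * x i else 0) := by
        intro i; rw [mul_comm]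
    simp only [this]; ring
  int x hx y hy := Lam_int N x y hx.1 hy.1
  even x hx := by
    obtain ⟨hx, a, ha⟩ := hx
    obtain ⟨m, hm⟩ := sq_par Finset.univ (fun i : Fin (N + 2) => if 4 ≤ (i : ℕ) then x i else 0)
      (by
        intro i _
        split_ifs
        · exact hx i
        · exact ⟨0, by simp⟩)
    rw [ha] at hm
    choose c hc using hx
    refine ⟨c 0 * c 1 + c 2 * c 3 - a - m, ?_⟩
    simp only [LamB_apply, LamForm]
    have : ∀ i : Fin (N + 2), (if 4 ≤ (i : ℕ) then x i * x i else 0)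
        = (if 4 ≤ (i : ℕ) then x i else 0) * (if 4 ≤ (i : ℕ) then x i else 0) := by
      intro i; split_ifs <;> simp
    simp only [this, hm]
    simp only [hc]
    push_cast; ring

theorem Lam_single_ge (N : ℕ) (hN : 5 ≤ N) (v : Fin (N + 2) → ℚ) (i : Fin (N + 2))
    (hi : 4 ≤ (i : ℕ)) (a : ℚ) : LamForm N v (Pi.single i a) = - (v i * a) := by
  have h0 : (0 : Fin (N + 2)) ≠ i := by intro h; rw [← h] at hi; simp at hi
  have h1 : (1 : Fin (N + 2)) ≠ i := by intro h; rw [← h] at hi; simp at hi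
  have h2 : (2 : Fin (N + 2)) ≠ i := by
    intro h; have e2 := fin_val2 N hN; have e3 := fin_val3 N hN; rw [← h] at hi; omega
  have h3 : (3 : Fin (N + 2)) ≠ i := by
    intro h; have e2 := fin_val2 N hN; have e3 := fin_val3 N hN; rw [← h] at hi; omega
  rw [LamForm, Pi.single_eq_of_ne h0, Pi.single_eq_of_ne h1, Pi.single_eq_of_ne h2,
    Pi.single_eq_of_ne h3, Finset.sum_eq_single i]
  · simp [hi]
  · intro j _ hj
    simp [Pi.single_eq_of_ne hj]
  · simp

theorem Lam_single_lt (N : ℕ) (v : Fin (N + 2) → ℚ) (i : Fin (N + 2))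
    (hi : (i : ℕ) < 4) (a : ℚ) : LamForm N v (Pi.single i a) =
      v 0 * (Pi.single i a : Fin (N + 2) → ℚ) 1 + v 1 * (Pi.single i a : Fin (N + 2) → ℚ) 0
      + v 2 * (Pi.single i a : Fin (N + 2) → ℚ) 3
      + v 3 * (Pi.single i a : Fin (N + 2) → ℚ) 2 := by
  rw [LamForm, Finset.sum_eq_zero, sub_zero]
  intro j _
  split_ifs with h
  · have : j ≠ i := by rintro rfl; omega
    simp [Pi.single_eq_of_ne this]
  · rfl

theorem fin_ne (N : ℕ) (hN : 5 ≤ N) (a b : ℕ) (ha : a < 4) (hb : b < 4) (h : a ≠ b) :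
    Fin.ofNat (N + 2) a ≠ Fin.ofNat (N + 2) b := by
  intro h'
  have := congrArg Fin.val h'
  rw [Fin.val_ofNat, Fin.val_ofNat, Nat.mod_eq_of_lt (by omega), Nat.mod_eq_of_lt (by omega)] at this
  exact h this

theorem Lam_u (N : ℕ) (hN : 5 ≤ N) (v : Fin (N + 2) → ℚ) :
    LamForm N v (Pi.single 0 1) = v 1 ∧ LamForm N v (Pi.single 1 1) = v 0 ∧
    LamForm N v (Pi.single 2 1) = v 3 ∧ LamForm N v (Pi.single 3 1) = v 2 := by
  have h01 : (0 : Fin (N + 2)) ≠ 1 := fin_ne N hN 0 1 (by omega) (by omega) (by omega)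
  have h02 : (0 : Fin (N + 2)) ≠ 2 := fin_ne N hN 0 2 (by omega) (by omega) (by omega)
  have h03 : (0 : Fin (N + 2)) ≠ 3 := fin_ne N hN 0 3 (by omega) (by omega) (by omega)
  have h12 : (1 : Fin (N + 2)) ≠ 2 := fin_ne N hN 1 2 (by omega) (by omega) (by omega)
  have h13 : (1 : Fin (N + 2)) ≠ 3 := fin_ne N hN 1 3 (by omega) (by omega) (by omega)
  have h23 : (2 : Fin (N + 2)) ≠ 3 := fin_ne N hN 2 3 (by omega) (by omega) (by omega)
  have e2 : ((2 : Fin (N + 2)) : ℕ) < 4 := by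
    have e2 := fin_val2 N hN; have e3 := fin_val3 N hN; omega
  have e3 : ((3 : Fin (N + 2)) : ℕ) < 4 := by
    have e2 := fin_val2 N hN; have e3 := fin_val3 N hN; omega
  refine ⟨?_, ?_, ?_, ?_⟩
  · rw [Lam_single_lt _ _ _ (by simp)]
    simp [Pi.single_apply, h01, h02, h03, h01.symm, h02.symm, h03.symm]
  · rw [Lam_single_lt _ _ _ (by simp)]
    simp [Pi.single_apply, h01, h12, h13, h01.symm, h12.symm, h13.symm]
  · rw [Lam_single_lt _ _ _ e2]
    simp [Pi.single_apply, h02, h12, h23, h02.symm, h12.symm, h23.symm]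
  · rw [Lam_single_lt _ _ _ e3]
    simp [Pi.single_apply, h03, h13, h23, h03.symm, h13.symm, h23.symm]

theorem single_int (N : ℕ) (i : Fin (N + 2)) (a : ℤ) :
    IntVec (Pi.single i (a : ℚ) : Fin (N + 2) → ℚ) := by
  intro j
  by_cases h : j = i
  · subst h; exact ⟨a, by simp⟩
  · exact ⟨0, by simp [Pi.single_eq_of_ne h]⟩

theorem single_mem (N : ℕ) (i : Fin (N + 2)) (hi : (i : ℕ) < 4) :
    (Pi.single i 1 : Fin (N + 2) → ℚ) ∈ LamL N := by
  refine ⟨by simpa using single_int N i 1, 0, ?_⟩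
  have := tailSum_single N i 1
  unfold tailSum at this
  rw [this, if_neg (by omega)]; simp

theorem Lam_hyp (N : ℕ) (hN : 5 ≤ N) :
    Hyp (LamB N) (LamL N) (Pi.single 0 1) (Pi.single 1 1) (Pi.single 2 1) (Pi.single 3 1) := by
  have h01 : (0 : Fin (N + 2)) ≠ 1 := fin_ne N hN 0 1 (by omega) (by omega) (by omega)
  have h02 : (0 : Fin (N + 2)) ≠ 2 := fin_ne N hN 0 2 (by omega) (by omega) (by omega)
  have h03 : (0 : Fin (N + 2)) ≠ 3 := fin_ne N hN 0 3 (by omega) (by omega) (by omega)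
  have h12 : (1 : Fin (N + 2)) ≠ 2 := fin_ne N hN 1 2 (by omega) (by omega) (by omega)
  have h13 : (1 : Fin (N + 2)) ≠ 3 := fin_ne N hN 1 3 (by omega) (by omega) (by omega)
  have h23 : (2 : Fin (N + 2)) ≠ 3 := fin_ne N hN 2 3 (by omega) (by omega) (by omega)
  have e2 : ((2 : Fin (N + 2)) : ℕ) < 4 := by
    have e2 := fin_val2 N hN; have e3 := fin_val3 N hN; omega
  have e3 : ((3 : Fin (N + 2)) : ℕ) < 4 := by
    have e2 := fin_val2 N hN; have e3 := fin_val3 N hN; omega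
  have hu := Lam_u N hN
  constructor
  case me => exact single_mem N _ (by simp)
  case mf => exact single_mem N _ (by simp)
  case me1 => exact single_mem N _ e2
  case mf1 => exact single_mem N _ e3
  all_goals
    simp only [LamB_apply, (hu _).1, (hu _).2.1, (hu _).2.2.1, (hu _).2.2.2]
    simp [Pi.single_apply, h01, h02, h03, h12, h13, h23, h01.symm, h02.symm, h03.symm, h12.symm,
      h13.symm, h23.symm]

theorem pair_mem (N : ℕ) (i j : Fin (N + 2)) (hi : 4 ≤ (i : ℕ)) (hj : 4 ≤ (j : ℕ)) (a b : ℤ)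
    (h : ∃ c : ℤ, a + b = 2 * c) :
    (Pi.single i (a : ℚ) + Pi.single j (b : ℚ) : Fin (N + 2) → ℚ) ∈ LamL N := by
  rw [mem_LamL]
  constructor
  · intro l
    obtain ⟨p, hp⟩ := single_int N i a l
    obtain ⟨q, hq⟩ := single_int N j b l
    exact ⟨p + q, by simp [hp, hq]⟩
  · obtain ⟨c, hc⟩ := h
    refine ⟨c, ?_⟩
    rw [tailSum_add, tailSum_single, tailSum_single, if_pos hi, if_pos hj]
    exact_mod_cast hc

/-- Structure of vectors of norm `-3/4` in the dual lattice. -/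
theorem dual_shape (N : ℕ) (hN : 5 ≤ N) (v : Fin (N + 2) → ℚ)
    (hv : ∀ x ∈ LamL N, ∃ n : ℤ, LamB N v x = n) (hn : LamForm N v v = -3/4) :
    ∀ i : Fin (N + 2), ((i : ℕ) < 4 → ∃ a : ℤ, v i = a) ∧
      (4 ≤ (i : ℕ) → ∃ a : ℤ, v i = a + 1/2) := by
  have e2 : ((2 : Fin (N + 2)) : ℕ) = 2 := by
    have e2 := fin_val2 N hN; have e3 := fin_val3 N hN; omega
  have e3 : ((3 : Fin (N + 2)) : ℕ) = 3 := by
    have e2 := fin_val2 N hN; have e3 := fin_val3 N hN; omega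
  have low : ∀ i : Fin (N + 2), (i : ℕ) < 4 → ∃ a : ℤ, v i = a := by
    intro i hi
    have hu := Lam_u N hN v
    have h4 : i = 0 ∨ i = 1 ∨ i = 2 ∨ i = 3 := by
      have : (i : ℕ) = 0 ∨ (i : ℕ) = 1 ∨ (i : ℕ) = 2 ∨ (i : ℕ) = 3 := by omega
      rcases this with h | h | h | h
      · left; ext; simp [h]
      · right; left; ext; simp [h]
      · right; right; left; ext; rw [h, e2]
      · right; right; right; ext; rw [h, e3]
    rcases h4 with rfl | rfl | rfl | rfl
    · rw [← hu.2.1]; exact hv _ (single_mem N _ (by simp))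
    · rw [← hu.1]; exact hv _ (single_mem N _ (by simp))
    · rw [← hu.2.2.2]; exact hv _ (single_mem N _ (by omega))
    · rw [← hu.2.2.1]; exact hv _ (single_mem N _ (by omega))
  have pair : ∀ i j : Fin (N + 2), 4 ≤ (i : ℕ) → 4 ≤ (j : ℕ) → ∀ a b : ℤ, 
      (∃ c : ℤ, a + b = 2 * c) → ∃ n : ℤ, v i * a + v j * b = n := by
    intro i j hi hj a b hab
    obtain ⟨n, hh⟩ := hv _ (pair_mem N i j hi hj a b hab)
    rw [map_add, LamB_apply, LamB_apply, Lam_single_ge N hN v i hi, Lam_single_ge N hN v j hj] at hh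
    exact ⟨-n, by push_cast; linarith⟩
  set q : Fin (N + 2) := ⟨4, by omega⟩ with hq
  obtain ⟨n, hn2⟩ := pair q q le_rfl le_rfl 1 1 ⟨1, by norm_num⟩
  push_cast at hn2
  have diff : ∀ i : Fin (N + 2), 4 ≤ (i : ℕ) → ∃ d : ℤ, v i = v q + d := by
    intro i hi
    obtain ⟨d, hd⟩ := pair i q hi le_rfl 1 (-1) ⟨0, by norm_num⟩
    exact ⟨d, by push_cast at hd; linarith⟩
  rcases Int.even_or_odd' n with ⟨c, hc | hc⟩
  · exfalso
    have hint : IntVec v := by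
      intro i
      by_cases hi : (i : ℕ) < 4
      · exact low i hi
      · obtain ⟨d, hd⟩ := diff i (by omega)
        refine ⟨c + d, ?_⟩
        rw [hc] at hn2
        push_cast at hn2 ⊢
        linarith
    obtain ⟨m, hm⟩ := Lam_int N v v hint hint
    rw [hn] at hm
    have : (4 * m : ℤ) = -3 := by
      have : (4 : ℚ) * m = -3 := by rw [← hm]; norm_num
      exact_mod_cast this
    omega
  · intro i
    refine ⟨low i, fun hi => ?_⟩
    obtain ⟨d, hd⟩ := diff i hi
    refine ⟨c + d, ?_⟩
    rw [hc] at hn2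
    push_cast at hn2 ⊢
    linarith

/-- Sign change of one coordinate. -/
def flipMap (N : ℕ) (q : Fin (N + 2)) : (Fin (N + 2) → ℚ) ≃ₗ[ℚ] (Fin (N + 2) → ℚ) :=
  LinearEquiv.piCongrRight
    (fun i => if i = q then LinearEquiv.neg ℚ else LinearEquiv.refl ℚ ℚ)

theorem flipMap_apply (N : ℕ) (q : Fin (N + 2)) (x : Fin (N + 2) → ℚ) (i : Fin (N + 2)) :
    flipMap N q x i = if i = q then - x i else x i := by
  unfold flipMap
  by_cases h : i = q <;> simp [h]

theorem flip_tail (N : ℕ) (q : Fin (N + 2)) (hq : 4 ≤ (q : ℕ)) (x : Fin (N + 2) → ℚ) :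
    tailSum N (flipMap N q x) = tailSum N x - 2 * x q := by
  have : flipMap N q x = x + - Pi.single q (2 * x q) := by
    ext i
    rw [flipMap_apply]
    by_cases h : i = q
    · subst h; simp; ring
    · simp [h]
  rw [this, tailSum_add, tailSum_neg, tailSum_single, if_pos hq]; ring

theorem flip_rel (N : ℕ) (hN : 5 ≤ N) (q : Fin (N + 2)) (hq : 4 ≤ (q : ℕ)) (v : Fin (N + 2) → ℚ) :
    LRel (LamB N) (LamL N) v (flipMap N q v) := by
  have h2 : ∀ x, flipMap N q (flipMap N q x) = x := by
    intro x; ext i; simp only [flipMap_apply]; split_ifs <;> simp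
  have hm : ∀ x, x ∈ LamL N → flipMap N q x ∈ LamL N := by
    intro x hx
    rw [mem_LamL] at hx ⊢
    obtain ⟨hx, a, ha⟩ := hx
    constructor
    · intro i
      obtain ⟨c, hc⟩ := hx i
      rw [flipMap_apply]
      split_ifs
      · exact ⟨-c, by simp [hc]⟩
      · exact ⟨c, hc⟩
    · obtain ⟨c, hc⟩ := hx q
      exact ⟨a - c, by rw [flip_tail N q hq, ha, hc]; push_cast; ring⟩
  refine ⟨flipMap N q, ?_, ?_, rfl⟩
  · intro x y
    have h0 : (0 : Fin (N + 2)) ≠ q := by intro h; rw [← h] at hq; simp at hq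
    have h1 : (1 : Fin (N + 2)) ≠ q := by intro h; rw [← h] at hq; simp at hq
    have h2 : (2 : Fin (N + 2)) ≠ q := by
      intro h; have e2 := fin_val2 N hN; have e3 := fin_val3 N hN; rw [← h] at hq; omega
    have h3 : (3 : Fin (N + 2)) ≠ q := by
      intro h; have e2 := fin_val2 N hN; have e3 := fin_val3 N hN; rw [← h] at hq; omega
    simp only [LamB_apply, LamForm, flipMap_apply, if_neg h0, if_neg h1, if_neg h2, if_neg h3]
    congr 1
    refine Finset.sum_congr rfl fun i _ => ?_
    split_ifs <;> ring
  · intro x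
    refine ⟨fun h => ?_, hm x⟩
    have := hm _ h
    rwa [h2] at this

/-- Transitivity on vectors of norm `-3/4` in the dual lattice. -/
theorem dual_trans (N : ℕ) (hN : 5 ≤ N) (v w : Fin (N + 2) → ℚ)
    (hv : PDual (LamB N) (LamL N) v) (hw : PDual (LamB N) (LamL N) w)
    (hnv : LamForm N v v = -3/4) (hnw : LamForm N w w = -3/4) :
    LRel (LamB N) (LamL N) v w := by
  set q : Fin (N + 2) := ⟨4, by omega⟩ with hq
  have hq4 : 4 ≤ (q : ℕ) := le_rfl
  have sub_int : ∀ v, PDual (LamB N) (LamL N) v → LamForm N v v = -3/4 → IntVec (v - w) := by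
    intro v hv hnv i
    have h1 := dual_shape N hN v hv.1 hnv i
    have h2 := dual_shape N hN w hw.1 hnw i
    by_cases hi : (i : ℕ) < 4
    · obtain ⟨a, ha⟩ := h1.1 hi
      obtain ⟨b, hb⟩ := h2.1 hi
      exact ⟨a - b, by simp [ha, hb]⟩
    · obtain ⟨a, ha⟩ := h1.2 (by omega)
      obtain ⟨b, hb⟩ := h2.2 (by omega)
      exact ⟨a - b, by simp [ha, hb]⟩
  have hi := sub_int v hv hnv
  obtain ⟨m, hm⟩ := int_sum Finset.univ
    (fun i : Fin (N + 2) => if 4 ≤ (i : ℕ) then (v - w) i else 0)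
      (by
        intro i _
        split_ifs
        · exact hi i
        · exact ⟨0, by simp⟩)
  have hm' : tailSum N (v - w) = m := hm
  rcases Int.even_or_odd' m with ⟨c, hc | hc⟩
  · refine eichler (Lam_even N) (Lam_hyp N hN) hv hw (by rw [LamB_apply, LamB_apply, hnv, hnw]) ?_
    rw [mem_LamL]
    exact ⟨hi, c, by rw [hm', hc]; push_cast; ring⟩
  · have hr := flip_rel N hN q hq4 v
    have hnv' : LamForm N (flipMap N q v) (flipMap N q v) = -3/4 := by
      rw [← hnv]
      obtain ⟨g, g1, -, g3⟩ := hr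
      have := g1 v v
      rwa [g3] at this
    have hv' := hv.rel hr
    refine hr.trans (eichler (Lam_even N) (Lam_hyp N hN) hv' hw
      (by rw [LamB_apply, LamB_apply, hnv', hnw]) ?_)
    rw [mem_LamL]
    refine ⟨sub_int _ hv' hnv', ?_⟩
    obtain ⟨a, ha⟩ := (dual_shape N hN v hv.1 hnv q).2 hq4
    refine ⟨c - a, ?_⟩
    rw [sub_eq_add_neg, tailSum_add, tailSum_neg] at hm' ⊢
    rw [flip_tail N q hq4, ha]
    rw [hc] at hm'
    push_cast at hm' ⊢
    linarith

end Concrete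

section Chain

set_option linter.unusedSimpArgs false

/-- Ambient space split in blocks. -/
abbrev WAmb (k : ℕ) := (Fin 4 → ℚ) × (Fin k → Fin 8 → ℚ) × (Fin 3 → ℚ)

/-- The form on `WAmb`. -/
def WF (k : ℕ) (x y : WAmb k) : ℚ :=
  UForm x.1 y.1 + ∑ j, negE (x.2.1 j) (y.2.1 j) + negE x.2.2 y.2.2

/-- Intermediate lattices: the first `j` blocks are `E₈`, the others integral. -/
def LSet (k j : ℕ) : Set (WAmb k) :=
  {x | IntVec x.1 ∧ (∀ i : Fin k, ((i : ℕ) < j → x.2.1 i ∈ E8Set) ∧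
    (j ≤ (i : ℕ) → IntVec (x.2.1 i))) ∧ IntVec x.2.2 ∧ ∃ a : ℤ, WF k x x = 2 * a}

/-- The auxiliary coordinate. -/
def auxA {k : ℕ} (j : Fin k) (p : WAmb k) : ℚ := p.1 0 + p.1 1 + p.2.1 j 0 + p.2.2 0

/-- Neighbour isometry, forward. -/
def Tfun {k : ℕ} (j : Fin k) (p : WAmb k) : WAmb k :=
  (![2 * auxA j p, p.1 1 + 1/2 * ∑ i, p.2.1 j i + 2 * auxA j p, p.1 2, p.1 3],
    fun l i => if l = j then p.2.1 l i + (if i = 0 then p.1 1 else 0) + auxA j p else p.2.1 l i,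
    ![p.2.2 0 + p.1 1, p.2.2 1, p.2.2 2])

/-- The auxiliary coordinate of the inverse. -/
def auxB {k : ℕ} (j : Fin k) (p : WAmb k) : ℚ := 2 * p.1 1 - ∑ i, p.2.1 j i + 2 * p.1 0

/-- Neighbour isometry, backward. -/
def Tinv {k : ℕ} (j : Fin k) (p : WAmb k) : WAmb k :=
  (![p.1 0 + auxB j p - p.2.1 j 0 - p.2.2 0, auxB j p, p.1 2, p.1 3],
    fun l i => if l = j then p.2.1 l i - (if i = 0 then auxB j p else 0) - p.1 0 / 2
      else p.2.1 l i,
    ![p.2.2 0 - auxB j p, p.2.2 1, p.2.2 2])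

theorem Tinv_Tfun {k : ℕ} (j : Fin k) (p : WAmb k) : Tinv j (Tfun j p) = p := by
  obtain ⟨u, X, Y⟩ := p
  have hB : auxB j (Tfun j (u, X, Y)) = u 1 := by
    simp [auxB, Tfun, auxA, Fin.sum_univ_eight]; ring
  refine Prod.ext ?_ (Prod.ext ?_ ?_)
  · ext i
    fin_cases i
    · simp [Tinv, hB]; simp [Tfun, auxA]; ring
    · simp [Tinv, hB]
    · simp [Tinv, Tfun]
    · simp [Tinv, Tfun]
  · ext l i
    simp only [Tinv, hB]
    by_cases h : l = j
    · simp [h, Tfun]; ring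
    · simp [h, Tfun]
  · ext i
    fin_cases i
    · simp [Tinv, hB]; simp [Tfun]
    · simp [Tinv, Tfun]
    · simp [Tinv, Tfun]

theorem Tfun_Tinv {k : ℕ} (j : Fin k) (p : WAmb k) : Tfun j (Tinv j p) = p := by
  obtain ⟨u, X, Y⟩ := p
  have hA : auxA j (Tinv j (u, X, Y)) = u 0 / 2 := by
    simp [auxA, Tinv]; ring
  refine Prod.ext ?_ (Prod.ext ?_ ?_)
  · ext i
    fin_cases i
    · simp [Tfun, hA]; ring
    · simp [Tfun, hA]; simp [Tinv, auxB, Fin.sum_univ_eight]; ring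
    · simp [Tinv, Tfun]
    · simp [Tinv, Tfun]
  · ext l i
    simp only [Tfun, hA]
    by_cases h : l = j
    · simp [h, Tinv]; ring
    · simp [h, Tinv]
  · ext i
    fin_cases i
    · simp [Tinv, Tfun]
    · simp [Tinv, Tfun]
    · simp [Tinv, Tfun]

/-- Neighbour isometry. -/
def Teq {k : ℕ} (j : Fin k) : WAmb k ≃ₗ[ℚ] WAmb k where
  toFun := Tfun j
  invFun := Tinv j
  left_inv := Tinv_Tfun j
  right_inv := Tfun_Tinv j
  map_add' := by
    rintro ⟨u, X, Y⟩ ⟨u', X', Y'⟩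
    refine Prod.ext ?_ (Prod.ext ?_ ?_)
    · ext i
      fin_cases i <;> simp [Tfun, auxA, Finset.sum_add_distrib] <;> ring
    · ext l i
      by_cases h : l = j <;> by_cases h' : i = 0 <;> simp [Tfun, auxA, h, h'] <;> ring
    · ext i
      fin_cases i <;> simp [Tfun] <;> ring
  map_smul' := by
    rintro c ⟨u, X, Y⟩
    refine Prod.ext ?_ (Prod.ext ?_ ?_)
    · ext i
      fin_cases i <;> simp [Tfun, auxA, ← Finset.mul_sum] <;> ring
    · ext l i
      by_cases h : l = j <;> by_cases h' : i = 0 <;> simp [Tfun, auxA, h, h'] <;> ring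
    · ext i
      fin_cases i <;> simp [Tfun] <;> ring

theorem Teq_iso {k : ℕ} (j : Fin k) (x y : WAmb k) : WF k (Tfun j x) (Tfun j y) = WF k x y := by
  have key : ∑ l, negE ((Tfun j x).2.1 l) ((Tfun j y).2.1 l) - ∑ l, negE (x.2.1 l) (y.2.1 l)
      = negE ((Tfun j x).2.1 j) ((Tfun j y).2.1 j) - negE (x.2.1 j) (y.2.1 j) := by
    rw [← Finset.sum_sub_distrib]
    apply Finset.sum_eq_single j
    · intro l _ hl
      simp [Tfun, hl]
    · simp
  have hk : ∑ l, negE ((Tfun j x).2.1 l) ((Tfun j y).2.1 l) = ∑ l, negE (x.2.1 l) (y.2.1 l)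
      + (negE ((Tfun j x).2.1 j) ((Tfun j y).2.1 j) - negE (x.2.1 j) (y.2.1 j)) := by
    linarith
  unfold WF
  rw [hk]
  simp [Tfun, UForm, negE, Fin.sum_univ_eight, Fin.sum_univ_three, auxA]
  ring

theorem Teq_fwd {k : ℕ} (j : Fin k) (x : WAmb k) (hx : x ∈ LSet k (j + 1)) :
    Tfun j x ∈ LSet k j := by
  obtain ⟨hu, hX, hY, a, ha⟩ := hx
  have hE := (hX j).1 (by omega)
  obtain ⟨hE1, s, hs⟩ := hE
  obtain ⟨u0, hu0⟩ := hu 0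
  obtain ⟨u1, hu1⟩ := hu 1
  obtain ⟨u2, hu2⟩ := hu 2
  obtain ⟨u3, hu3⟩ := hu 3
  obtain ⟨y0, hy0⟩ := hY 0
  obtain ⟨y1, hy1⟩ := hY 1
  obtain ⟨y2, hy2⟩ := hY 2
  have h2A : ∃ c : ℤ, 2 * auxA j x = c ∧ ∀ i, ∃ d : ℤ, x.2.1 j i + auxA j x = d := by
    rcases hE1 with h | h
    · choose n hn using h
      refine ⟨2 * (u0 + u1 + n 0 + y0), ?_, fun i => ⟨n i + (u0 + u1 + n 0 + y0), ?_⟩⟩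
      · simp only [auxA, hu0, hu1, hn, hy0]; push_cast; ring
      · simp only [auxA, hu0, hu1, hn, hy0]; push_cast; ring
    · choose n hn using h
      have hn' : ∀ i, x.2.1 j i = n i + 1/2 := by
        intro i
        have := hn i
        simp only [Pi.sub_apply, halfVec] at this
        linarith
      refine ⟨2 * (u0 + u1 + n 0 + y0) + 1, ?_, fun i => ⟨n i + (u0 + u1 + n 0 + y0) + 1, ?_⟩⟩
      · simp only [auxA, hu0, hu1, hn', hy0]; push_cast; ring
      · simp only [auxA, hu0, hu1, hn', hy0]; push_cast; ring
  obtain ⟨c, hc, hd⟩ := h2A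
  refine ⟨?_, ?_, ?_, a, by rw [Teq_iso, ha]⟩
  · intro i
    fin_cases i
    · exact ⟨c, by simp [Tfun, hc]⟩
    · exact ⟨u1 + s + c, by simp [Tfun, hc, hu1, hs]⟩
    · exact ⟨u2, by simp [Tfun, hu2]⟩
    · exact ⟨u3, by simp [Tfun, hu3]⟩
  · intro l
    by_cases h : l = j
    · subst h
      refine ⟨fun h => absurd h (lt_irrefl _), fun _ i => ?_⟩
      obtain ⟨d, hd⟩ := hd i
      by_cases hi : i = 0
      · exact ⟨d + u1, by simp [Tfun, hi]; rw [hi] at hd; rw [← hd, hu1]; ring⟩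
      · exact ⟨d, by simp [Tfun, hi, hd]⟩
    · have e : (Tfun j x).2.1 l = x.2.1 l := by ext i; simp [Tfun, h]
      have hne : (l : ℕ) ≠ j := fun h' => h (Fin.ext h')
      rw [e]
      exact ⟨fun h => (hX l).1 (by omega), fun h => (hX l).2 (by omega)⟩
  · intro i
    fin_cases i
    · exact ⟨y0 + u1, by simp [Tfun, hy0, hu1]⟩
    · exact ⟨y1, by simp [Tfun, hy1]⟩
    · exact ⟨y2, by simp [Tfun, hy2]⟩

theorem Teq_bwd {k : ℕ} (j : Fin k) (x : WAmb k) (hx : x ∈ LSet k j) :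
    Tinv j x ∈ LSet k (j + 1) := by
  obtain ⟨hu, hX, hY, a, ha⟩ := hx
  have hI := (hX j).2 le_rfl
  obtain ⟨s, hs⟩ := int_sum Finset.univ (x.2.1 j) (fun i _ => hI i)
  obtain ⟨u0, hu0⟩ := hu 0
  obtain ⟨u1, hu1⟩ := hu 1
  obtain ⟨u2, hu2⟩ := hu 2
  obtain ⟨u3, hu3⟩ := hu 3
  obtain ⟨y0, hy0⟩ := hY 0
  obtain ⟨y1, hy1⟩ := hY 1
  obtain ⟨y2, hy2⟩ := hY 2
  choose n hn using hI
  have hB : auxB j x = ((2 * u1 - s + 2 * u0 : ℤ) : ℚ) := by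
    simp only [auxB, hu1, hu0, hs]; push_cast; ring
  set b : ℤ := 2 * u1 - s + 2 * u0 with hb
  refine ⟨?_, ?_, ?_, a, ?_⟩
  · intro i
    fin_cases i
    · exact ⟨u0 + b - n 0 - y0, by simp [Tinv, hB, hu0, hn, hy0]⟩
    · exact ⟨b, by simp [Tinv, hB]⟩
    · exact ⟨u2, by simp [Tinv, hu2]⟩
    · exact ⟨u3, by simp [Tinv, hu3]⟩
  · intro l
    by_cases h : l = j
    · subst h
      refine ⟨fun _ => ⟨?_, s - u1 - 3 * u0, ?_⟩, fun h => by omega⟩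
      · rcases Int.even_or_odd' u0 with ⟨c, hc | hc⟩
        · left
          intro i
          by_cases hi : i = 0
          · exact ⟨n i - b - c, by simp [Tinv, hi, hB, hn, hu0, hc]⟩
          · exact ⟨n i - c, by simp [Tinv, hi, hn, hu0, hc]⟩
        · right
          intro i
          by_cases hi : i = 0
          · exact ⟨n i - b - c - 1, by simp [Tinv, hi, hB, hn, hu0, hc, halfVec]; ring⟩
          · exact ⟨n i - c - 1, by simp [Tinv, hi, hn, hu0, hc, halfVec]; ring⟩
      · have : ∑ i, (Tinv l x).2.1 l i = ∑ i, x.2.1 l i - b - 4 * u0 := by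
          simp [Tinv, Fin.sum_univ_eight, hB, hu0]; ring
        rw [this, hs, hb]; push_cast; ring
    · have e : (Tinv j x).2.1 l = x.2.1 l := by ext i; simp [Tinv, h]
      have hne : (l : ℕ) ≠ j := fun h' => h (Fin.ext h')
      rw [e]
      exact ⟨fun h => (hX l).1 (by omega), fun h => (hX l).2 (by omega)⟩
  · intro i
    fin_cases i
    · exact ⟨y0 - b, by simp [Tinv, hy0, hB]⟩
    · exact ⟨y1, by simp [Tinv, hy1]⟩
    · exact ⟨y2, by simp [Tinv, hy2]⟩
  · rw [← Teq_iso j, Tfun_Tinv, ha]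

theorem chain (k j : ℕ) (hj : j ≤ k) : ∃ g : WAmb k ≃ₗ[ℚ] WAmb k,
    (∀ x y, WF k (g x) (g y) = WF k x y) ∧ ∀ x, g x ∈ LSet k 0 ↔ x ∈ LSet k j := by
  induction j with
  | zero => exact ⟨LinearEquiv.refl ℚ _, by simp, by simp⟩
  | succ j ih =>
    obtain ⟨g, h1, h2⟩ := ih (by omega)
    let q : Fin k := ⟨j, by omega⟩
    refine ⟨(Teq q).trans g, ?_, ?_⟩
    · intro x y
      simp only [LinearEquiv.trans_apply, h1]
      exact Teq_iso q x y
    · intro x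
      simp only [LinearEquiv.trans_apply, h2]
      refine ⟨fun h => ?_, fun h => Teq_fwd q x h⟩
      have := Teq_bwd q _ h
      have e : Tinv q (Teq q x) = x := Tinv_Tfun q x
      rwa [e] at this

theorem E8_even (x : Fin 8 → ℚ) (hx : x ∈ E8Set) : ∃ a : ℤ, negE x x = 2 * a := by
  obtain ⟨h | h, s, hs⟩ := hx
  · obtain ⟨m, hm⟩ := sq_par Finset.univ x (fun i _ => h i)
    exact ⟨-(s + m), by rw [negE, hm, hs]; push_cast; ring⟩
  · obtain ⟨m, hm⟩ := sq_par Finset.univ (x - halfVec 8) (fun i _ => h i)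
    refine ⟨-(s + m + s - 3), ?_⟩
    simp only [Fin.sum_univ_eight, Pi.sub_apply, halfVec] at hm hs
    simp only [negE, Fin.sum_univ_eight]
    push_cast
    linarith

theorem II_even (k : ℕ) (u : Fin 4 → ℚ) (X : Fin k → Fin 8 → ℚ) (hu : IntVec u)
    (hX : ∀ j, X j ∈ E8Set) : ∃ a : ℤ, UForm u u + ∑ j, negE (X j) (X j) = 2 * a := by
  choose n hn using hu
  choose m hm using fun j => E8_even (X j) (hX j)
  refine ⟨n 0 * n 1 + n 2 * n 3 + ∑ j, m j, ?_⟩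
  simp only [UForm, hn, hm, ← Finset.mul_sum]
  push_cast
  ring

theorem mem_LSet_top (k : ℕ) (x : WAmb k) : x ∈ LSet k k ↔
    IntVec x.1 ∧ (∀ j, x.2.1 j ∈ E8Set) ∧ IntVec x.2.2 ∧ ∃ a : ℤ, ∑ i, x.2.2 i = 2 * a := by
  constructor
  · rintro ⟨h1, h2, h3, a, ha⟩
    have h2' : ∀ j, x.2.1 j ∈ E8Set := fun j => (h2 j).1 j.2
    refine ⟨h1, h2', h3, ?_⟩
    obtain ⟨b, hb⟩ := II_even k x.1 x.2.1 h1 h2'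
    obtain ⟨m, hm⟩ := sq_par Finset.univ x.2.2 (fun i _ => h3 i)
    refine ⟨b - a - m, ?_⟩
    unfold WF at ha
    rw [hb, negE, hm] at ha
    push_cast
    linarith
  · rintro ⟨h1, h2, h3, a, ha⟩
    obtain ⟨b, hb⟩ := II_even k x.1 x.2.1 h1 h2
    obtain ⟨m, hm⟩ := sq_par Finset.univ x.2.2 (fun i _ => h3 i)
    refine ⟨h1, fun i => ⟨fun _ => h2 i, fun h => absurd i.2 (by omega)⟩, h3, b - a - m, ?_⟩
    unfold WF
    rw [hb, negE, hm, ha]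
    push_cast
    ring

theorem mem_LSet_zero (k : ℕ) (x : WAmb k) : x ∈ LSet k 0 ↔
    IntVec x.1 ∧ (∀ j, IntVec (x.2.1 j)) ∧ IntVec x.2.2 ∧
      ∃ a : ℤ, ∑ j, ∑ i, x.2.1 j i + ∑ i, x.2.2 i = 2 * a := by
  have aux : ∀ (h1 : IntVec x.1) (h2 : ∀ j, IntVec (x.2.1 j)) (h3 : IntVec x.2.2), ∃ m : ℤ,
      WF k x x = 2 * m - (∑ j, ∑ i, x.2.1 j i + ∑ i, x.2.2 i) := by
    intro h1 h2 h3
    obtain ⟨m, hm⟩ := sq_par Finset.univ x.2.2 (fun i _ => h3 i)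
    choose c hc using fun j => sq_par Finset.univ (x.2.1 j) (fun i _ => h2 j i)
    choose n hn using h1
    refine ⟨n 0 * n 1 + n 2 * n 3 - ∑ j, c j - m, ?_⟩
    simp only [WF, negE, hc, hm, Finset.sum_neg_distrib, Finset.sum_add_distrib, UForm, hn,
      ← Finset.mul_sum]
    push_cast
    ring
  constructor
  · rintro ⟨h1, h2, h3, a, ha⟩
    have h2' : ∀ j, IntVec (x.2.1 j) := fun j => (h2 j).2 (Nat.zero_le _)
    obtain ⟨m, hm⟩ := aux h1 h2' h3
    exact ⟨h1, h2', h3, m - a, by push_cast; linarith⟩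
  · rintro ⟨h1, h2, h3, a, ha⟩
    obtain ⟨m, hm⟩ := aux h1 h2 h3
    exact ⟨h1, fun i => ⟨fun h => absurd h (by omega), fun _ => h2 i⟩, h3, m - a,
      by push_cast; linarith⟩

end Chain

section Final

set_option linter.unusedSimpArgs false

theorem exists_index (N k : ℕ) (h : N = 8 * k + 5) :
    ∃ σ : (Fin 4 ⊕ ((Fin k × Fin 8) ⊕ Fin 3)) ≃ Fin (N + 2),
      (∀ i, ((σ (Sum.inl i) : Fin (N + 2)) : ℕ) = i) ∧
      ∀ i, 4 ≤ ((σ (Sum.inr i) : Fin (N + 2)) : ℕ) := by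
  refine ⟨(Equiv.sumCongr (Equiv.refl (Fin 4))
    ((Equiv.sumCongr finProdFinEquiv (Equiv.refl (Fin 3))).trans finSumFinEquiv)).trans
    (finSumFinEquiv.trans (finCongr (by omega))), ?_, ?_⟩
  · intro i
    simp
  · intro i
    simp

/-- Reindexing of coordinates. -/
def Rix {N k : ℕ} (σ : (Fin 4 ⊕ ((Fin k × Fin 8) ⊕ Fin 3)) ≃ Fin (N + 2)) :
    WAmb k ≃ₗ[ℚ] (Fin (N + 2) → ℚ) where
  toFun x := fun i => Sum.elim x.1 (Sum.elim (fun p => x.2.1 p.1 p.2) x.2.2) (σ.symm i)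
  invFun y := (fun i => y (σ (Sum.inl i)), fun j i => y (σ (Sum.inr (Sum.inl (j, i)))),
    fun i => y (σ (Sum.inr (Sum.inr i))))
  left_inv := by
    rintro ⟨u, X, Y⟩
    simp
  right_inv := by
    intro y
    ext i
    obtain ⟨s, rfl⟩ := σ.surjective i
    rcases s with s | s | s <;> simp
  map_add' := by
    intro x y
    ext i
    obtain ⟨s, rfl⟩ := σ.surjective i
    rcases s with s | s | s <;> simp
  map_smul' := by
    intro c x
    ext i
    obtain ⟨s, rfl⟩ := σ.surjective i
    rcases s with s | s | s <;> simp

theorem Rix_apply {N k : ℕ} (σ : (Fin 4 ⊕ ((Fin k × Fin 8) ⊕ Fin 3)) ≃ Fin (N + 2))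
    (x : WAmb k) (s : Fin 4 ⊕ ((Fin k × Fin 8) ⊕ Fin 3)) :
    Rix σ x (σ s) = Sum.elim x.1 (Sum.elim (fun p => x.2.1 p.1 p.2) x.2.2) s := by
  simp [Rix]

theorem reindex (N k : ℕ) (h : N = 8 * k + 5) :
    ∃ R : WAmb k ≃ₗ[ℚ] (Fin (N + 2) → ℚ),
      (∀ x y, LamForm N (R x) (R y) = WF k x y) ∧ ∀ x, R x ∈ LamSet N ↔ x ∈ LSet k 0 := by
  obtain ⟨σ, h1, h2⟩ := exists_index N k h
  have hs : ∀ (f : Fin (N + 2) → ℚ), ∑ i : Fin (N + 2), (if 4 ≤ (i : ℕ) then f i else 0) =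
      ∑ j, ∑ i, f (σ (Sum.inr (Sum.inl (j, i)))) + ∑ i, f (σ (Sum.inr (Sum.inr i))) := by
    intro f
    rw [← Equiv.sum_comp σ, Fintype.sum_sum_type, Fintype.sum_sum_type, Fintype.sum_prod_type]
    simp only [h1, h2, if_true]
    rw [Finset.sum_eq_zero, zero_add]
    intro i _
    rw [if_neg (by omega)]
  have hc : ∀ i : Fin 4, ∀ j : Fin (N + 2), (j : ℕ) = i → ∀ x, Rix σ x j = x.1 i := by
    intro i j hj x
    have : j = σ (Sum.inl i) := Fin.ext (by rw [h1, hj])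
    rw [this, Rix_apply]; rfl
  refine ⟨Rix σ, ?_, ?_⟩
  · intro x y
    unfold LamForm
    rw [hs]
    have e0 := hc 0 0 (by simp)
    have e1 := hc 1 1 (by simp)
    have e2 := hc 2 2 (by rw [fin_val2 N (by omega)]; rfl)
    have e3 := hc 3 3 (by rw [fin_val3 N (by omega)]; rfl)
    simp only [e0, e1, e2, e3, Rix_apply, Sum.elim_inl, Sum.elim_inr, WF, UForm, negE,
      Finset.sum_neg_distrib]
    ring
  · intro x
    rw [mem_LSet_zero]
    unfold LamSet
    rw [Set.mem_setOf_eq, hs]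
    simp only [Rix_apply, Sum.elim_inl, Sum.elim_inr]
    constructor
    · rintro ⟨hi, a, ha⟩
      refine ⟨fun i => ?_, fun j i => ?_, fun i => ?_, a, ha⟩
      · have := hi (σ (Sum.inl i)); rwa [Rix_apply] at this
      · have := hi (σ (Sum.inr (Sum.inl (j, i)))); rwa [Rix_apply] at this
      · have := hi (σ (Sum.inr (Sum.inr i))); rwa [Rix_apply] at this
    · rintro ⟨hu, hX, hY, a, ha⟩
      refine ⟨fun i => ?_, a, ha⟩
      obtain ⟨s, rfl⟩ := σ.surjective i
      rw [Rix_apply]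
      rcases s with s | s | s
      · exact hu s
      · exact hX s.1 s.2
      · exact hY s

theorem big_equiv (N k : ℕ) (h : N = 8 * k + 5) :
    ∃ R : WAmb k ≃ₗ[ℚ] (Fin (N + 2) → ℚ),
      (∀ x y, LamForm N (R x) (R y) = WF k x y) ∧ ∀ x, R x ∈ LamSet N ↔ x ∈ LSet k k := by
  obtain ⟨R, h1, h2⟩ := reindex N k h
  obtain ⟨g, g1, g2⟩ := chain k k le_rfl
  refine ⟨g.trans R, fun x y => ?_, fun x => ?_⟩
  · rw [LinearEquiv.trans_apply, LinearEquiv.trans_apply, h1, g1]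
  · rw [LinearEquiv.trans_apply, h2, g2]

/-- The reference dual vector. -/
def wRef (k : ℕ) : WAmb k := (0, 0, fun _ => 1/2)

theorem WF_wRef (k : ℕ) (x : WAmb k) : WF k (wRef k) x = - (1/2) * ∑ i, x.2.2 i := by
  simp [WF, wRef, UForm, negE, ← Finset.mul_sum]

theorem WF_comm (k : ℕ) (x y : WAmb k) : WF k x y = WF k y x := by
  simp only [WF, UForm, negE, mul_comm]
  ring

/-- The embedding of `II ⊕ A₂` into the reference lattice. -/
def F0 (k : ℕ) : (IIAmb k × (Fin 2 → ℚ)) →ₗ[ℚ] WAmb k where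
  toFun p := (p.1.1, p.1.2, ![p.2 0, p.2 1 - p.2 0, - p.2 1])
  map_add' := by
    intro x y
    refine Prod.ext rfl (Prod.ext rfl ?_)
    ext i
    fin_cases i <;> simp <;> ring
  map_smul' := by
    intro c x
    refine Prod.ext rfl (Prod.ext rfl ?_)
    ext i
    fin_cases i <;> simp <;> ring

theorem F0_apply (k : ℕ) (p : IIAmb k × (Fin 2 → ℚ)) :
    F0 k p = (p.1.1, p.1.2, ![p.2 0, p.2 1 - p.2 0, - p.2 1]) := rfl

theorem F0_inj (k : ℕ) : Function.Injective (F0 k) := by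
  rintro ⟨⟨u, X⟩, q⟩ ⟨⟨u', X'⟩, q'⟩ h
  rw [F0_apply, F0_apply] at h
  simp only [Prod.mk.injEq] at h
  obtain ⟨rfl, rfl, h⟩ := h
  have h0 := congrFun h 0
  have h2 := congrFun h 2
  simp at h0 h2
  have : q = q' := by
    ext i
    fin_cases i
    · exact h0
    · exact h2
  rw [this]

theorem F0_iso (k : ℕ) (x y : IIAmb k × (Fin 2 → ℚ)) :
    WF k (F0 k x) (F0 k y) = IIForm k x.1 y.1 + A2Form x.2 y.2 := by
  rw [F0_apply, F0_apply]
  simp only [WF, IIForm, A2Form]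
  simp [negE, Fin.sum_univ_three]
  ring

theorem F0_image (k : ℕ) (x : WAmb k) :
    (x ∈ LSet k k ∧ WF k (wRef k) x = 0) ↔
      ∃ p : IIAmb k × (Fin 2 → ℚ), (p.1 ∈ IISet k ∧ IntVec p.2) ∧ F0 k p = x := by
  rw [mem_LSet_top, WF_wRef]
  constructor
  · rintro ⟨⟨hu, hX, hY, -⟩, h0⟩
    refine ⟨((x.1, x.2.1), ![x.2.2 0, - x.2.2 2]), ⟨⟨hu, hX⟩, ?_⟩, ?_⟩
    · intro i
      fin_cases i
      · exact hY 0
      · obtain ⟨a, ha⟩ := hY 2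
        exact ⟨-a, by simp [ha]⟩
    · rw [F0_apply]
      refine Prod.ext rfl (Prod.ext rfl ?_)
      rw [Fin.sum_univ_three] at h0
      ext i
      fin_cases i
      · simp
      · simp; linarith
      · simp
  · rintro ⟨p, ⟨⟨hu, hX⟩, hq⟩, rfl⟩
    rw [F0_apply]
    obtain ⟨a, ha⟩ := hq 0
    obtain ⟨b, hb⟩ := hq 1
    refine ⟨⟨hu, hX, ?_, 0, ?_⟩, ?_⟩
    · intro i
      fin_cases i
      · exact ⟨a, by simp [ha]⟩
      · exact ⟨b - a, by simp [ha, hb]⟩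
      · exact ⟨-b, by simp [hb]⟩
    · simp [Fin.sum_univ_three]
    · simp [Fin.sum_univ_three]

theorem final_aux (N k : ℕ) (h : N = 8 * k + 5)
    (v : Fin (N + 2) → ℚ)
    (hv2 : LamForm N v v = -12)
    (hdiv : HasDiv N v 4) :
    ∃ F : (IIAmb k × (Fin 2 → ℚ)) →ₗ[ℚ] (Fin (N + 2) → ℚ),
      Function.Injective F ∧
      (∀ x y : IIAmb k × (Fin 2 → ℚ),
        LamForm N (F x) (F y) = IIForm k x.1 y.1 + A2Form x.2 y.2) ∧
      F '' {p | p.1 ∈ IISet k ∧ IntVec p.2} =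
        {x | x ∈ LamSet N ∧ LamForm N x v = 0} := by
  obtain ⟨G, G1, G2⟩ := big_equiv N k h
  have hw : PDual (LamB N) (LamL N) (G (wRef k)) := by
    constructor
    · intro x hx
      obtain ⟨y, rfl⟩ := G.surjective x
      rw [mem_LamL', G2, mem_LSet_top] at hx
      obtain ⟨-, -, -, a, ha⟩ := hx
      refine ⟨-a, ?_⟩
      rw [LamB_apply, G1, WF_wRef, ha]
      push_cast; ring
    · refine ⟨G (0, 0, ![-1, -1, 0]), ?_, ?_⟩
      · rw [mem_LamL', G2, mem_LSet_top]
        refine ⟨fun i => ⟨0, by simp⟩, fun j => ⟨Or.inl fun i => ⟨0, by simp⟩, 0, by simp⟩,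
          fun i => ?_, -1, ?_⟩
        · fin_cases i
          · exact ⟨-1, by simp⟩
          · exact ⟨-1, by simp⟩
          · exact ⟨0, by simp⟩
        · simp [Fin.sum_univ_three]; norm_num
      · rw [LamB_apply, G1, WF_wRef]
        simp [Fin.sum_univ_three]; norm_num
  have hnw : LamForm N (G (wRef k)) (G (wRef k)) = -3/4 := by
    rw [G1, WF_wRef]
    simp [wRef, Fin.sum_univ_three]; norm_num
  have hvs : ∀ x, LamForm N ((1/4 : ℚ) • v) x = 1/4 * LamForm N v x := by
    intro x
    rw [← LamB_apply, map_smul, LinearMap.smul_apply, LamB_apply, smul_eq_mul]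
  have hsymm : ∀ x y, LamForm N x y = LamForm N y x := by
    intro x y
    simp only [LamForm, mul_comm]
    ring
  have hv : PDual (LamB N) (LamL N) ((1/4 : ℚ) • v) := by
    obtain ⟨d1, x, hx, d2⟩ := hdiv
    constructor
    · intro y hy
      obtain ⟨a, ha⟩ := d1 y hy
      refine ⟨a, ?_⟩
      rw [LamB_apply, hvs, ha]; push_cast; ring
    · refine ⟨x, hx, ?_⟩
      rw [LamB_apply, hvs, d2]; norm_num
  have hnv : LamForm N ((1/4 : ℚ) • v) ((1/4 : ℚ) • v) = -3/4 := by
    rw [hvs, hsymm, hvs, hv2]; norm_num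
  obtain ⟨g, g1, g2, g3⟩ := dual_trans N (by omega) _ _ hw hv hnw hnv
  refine ⟨g.toLinearMap.comp (G.toLinearMap.comp (F0 k)), ?_, ?_, ?_⟩
  · exact g.injective.comp (G.injective.comp (F0_inj k))
  · intro x y
    rw [← F0_iso, ← G1]
    exact g1 _ _
  · ext x
    obtain ⟨y, rfl⟩ := (G.trans g).surjective x
    have e1 : (G.trans g) y ∈ LamSet N ↔ y ∈ LSet k k := by
      rw [← G2]
      exact g2 (G y)
    have e2 : LamForm N ((G.trans g) y) v = 0 ↔ WF k (wRef k) y = 0 := by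
      have := g1 (G (wRef k)) (G y)
      rw [g3, LamB_apply, LamB_apply, G1, hvs, hsymm] at this
      rw [← this, LinearEquiv.trans_apply]
      constructor
      · intro h; rw [h]; simp
      · intro h; linarith
    rw [Set.mem_setOf_eq, e1, e2, F0_image]
    constructor
    · rintro ⟨p, hp, hp2⟩
      exact ⟨p, hp, (G.trans g).injective hp2⟩
    · rintro ⟨p, hp, rfl⟩
      exact ⟨p, hp, rfl⟩

end Final

/-- Let `(Λ, ξ)` be a decorated `D`-lattice of dimension `N = 8k + 5`, and let `v` be a
unigonal vector (`v² = -12`, `div(v) = 4`).  Then `v^⊥` is isomorphic, as a lattice, to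
`II_{2,2+8k} ⊕ A₂`. -/
theorem statement16 (N : ℕ) (hN : 5 ≤ N) (hmod : N % 8 = 5)
    (v : Fin (N + 2) → ℚ) (hv : v ∈ LamSet N)
    (hv2 : LamForm N v v = -12)
    (hdiv : HasDiv N v 4) :
    ∃ F : (IIAmb (N / 8) × (Fin 2 → ℚ)) →ₗ[ℚ] (Fin (N + 2) → ℚ),
      Function.Injective F ∧
      (∀ x y : IIAmb (N / 8) × (Fin 2 → ℚ),
        LamForm N (F x) (F y) = IIForm (N / 8) x.1 y.1 + A2Form x.2 y.2) ∧
      F '' {p | p.1 ∈ IISet (N / 8) ∧ IntVec p.2} =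
        {x | x ∈ LamSet N ∧ LamForm N x v = 0} := by
  exact final_aux N (N / 8) (by omega) v hv2 hdiv
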